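/- For every T > 0, M ≥ 1 and ε ∈ (0,1] there exists a constant C > 0, depending only on M, ε and T, such that every smooth solution (v,u,θ,q) of the radiation hydrodynamics system on [0,T] with (M,ε)-bounded initial data satisfies ‖θ(t,·)‖_{L^∞} ≤ C(1 + 𝔜(t)^{1/(2β+3)}) for all t ∈ [0,T]. -/

import Mathlib

open MeasureTheory Real Set

noncomputable section

namespace RadHydro

/-- Integral over one period `[-1/2, 1/2]` of the torus `𝕋 ≅ ℝ/ℤ`. -/
def tInt (f : ℝ → ℝ) : ℝ := ∫ x in (-(1/2) : ℝ)..(1/2 : ℝ), f x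

/-- Squared `L²` norm over the torus. -/
def L2sq (f : ℝ → ℝ) : ℝ := tInt fun x => (f x) ^ 2

/-- `L^∞` norm over the torus. -/
def Linf (f : ℝ → ℝ) : ℝ := sSup ((fun x => |f x|) '' Icc (-(1/2) : ℝ) (1/2))

/-- Squared `H¹` norm over the torus. -/
def H1sq (f : ℝ → ℝ) : ℝ := L2sq f + L2sq (deriv f)

/-- Squared `H²` norm over the torus. -/
def H2sq (f : ℝ → ℝ) : ℝ := L2sq f + L2sq (deriv f) + L2sq (deriv (deriv f))

/-- Partial derivative in the time variable. -/
def pt (f : ℝ → ℝ → ℝ) (t x : ℝ) : ℝ := deriv (fun s => f s x) t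

/-- Partial derivative in the space variable. -/
def px (f : ℝ → ℝ → ℝ) (t x : ℝ) : ℝ := deriv (f t) x

/-- The heat conductivity `κ(v, θ) = κ₁ + κ₂ v θ^β`. -/
def kappa (κ₁ κ₂ β v θ : ℝ) : ℝ := κ₁ + κ₂ * v * θ ^ β

/-- A smooth solution of the radiation hydrodynamics system (in Lagrangian
coordinates) on `[0, T]`: four `C^∞` functions on `[0,T] × ℝ` (modelled as smooth
functions on all of `ℝ × ℝ`), `1`-periodic in the space variable, with `v > 0`,
`θ > 0`, satisfying the four equations pointwise for `t ∈ [0, T]`, and with the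
normalization `∫_𝕋 v(0, x) dx = 1`. -/
structure Sol (μ R a b κ₁ κ₂ β γ T : ℝ) where
  v : ℝ → ℝ → ℝ
  u : ℝ → ℝ → ℝ
  θ : ℝ → ℝ → ℝ
  q : ℝ → ℝ → ℝ
  smooth_v : ContDiff ℝ (⊤ : ℕ∞) fun p : ℝ × ℝ => v p.1 p.2
  smooth_u : ContDiff ℝ (⊤ : ℕ∞) fun p : ℝ × ℝ => u p.1 p.2
  smooth_θ : ContDiff ℝ (⊤ : ℕ∞) fun p : ℝ × ℝ => θ p.1 p.2
  smooth_q : ContDiff ℝ (⊤ : ℕ∞) fun p : ℝ × ℝ => q p.1 p.2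
  periodic_v : ∀ t, Function.Periodic (v t) 1
  periodic_u : ∀ t, Function.Periodic (u t) 1
  periodic_θ : ∀ t, Function.Periodic (θ t) 1
  periodic_q : ∀ t, Function.Periodic (q t) 1
  v_pos : ∀ t x, 0 < v t x
  θ_pos : ∀ t x, 0 < θ t x
  eq_mass : ∀ t ∈ Icc (0 : ℝ) T, ∀ x : ℝ, pt v t x - px u t x = 0
  eq_mom : ∀ t ∈ Icc (0 : ℝ) T, ∀ x : ℝ,
    pt u t x + px (fun s y => R * θ s y / v s y) t x
      = px (fun s y => μ * px u s y / v s y) t x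
  eq_energy : ∀ t ∈ Icc (0 : ℝ) T, ∀ x : ℝ,
    pt (fun s y => R / (γ - 1) * θ s y + (u s y) ^ 2 / 2) t x
      + px (fun s y => R * θ s y / v s y * u s y) t x + px q t x
      = px (fun s y => μ * u s y * px u s y / v s y) t x
        + px (fun s y => kappa κ₁ κ₂ β (v s y) (θ s y) * px θ s y / v s y) t x
  eq_rad : ∀ t ∈ Icc (0 : ℝ) T, ∀ x : ℝ,
    -px (fun s y => px q s y / v s y) t x + a * v t x * q t x
      + b * px (fun s y => (θ s y) ^ 4) t x = 0
  mean_v : tInt (v 0) = 1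

/-- `(M, ε)`-bounded initial data: `‖(v₀, u₀, θ₀)‖_{H²} ≤ M` and `v₀ ≥ ε`, `θ₀ ≥ ε`. -/
def DataBounded (M ε : ℝ) (v₀ u₀ θ₀ : ℝ → ℝ) : Prop :=
  Real.sqrt (H2sq v₀ + H2sq u₀ + H2sq θ₀) ≤ M ∧ (∀ x, ε ≤ v₀ x) ∧ ∀ x, ε ≤ θ₀ x

variable {μ R a b κ₁ κ₂ β γ T : ℝ}

/-- A solution has `(M, ε)`-bounded initial data. -/
def Sol.Bounded (S : Sol μ R a b κ₁ κ₂ β γ T) (M ε : ℝ) : Prop :=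
  DataBounded M ε (S.v 0) (S.u 0) (S.θ 0)

/-- The auxiliary function `𝔛(t) = ∫₀ᵗ ∫_𝕋 κ(v,θ) θ_t² / v dx ds`. -/
def Sol.X (S : Sol μ R a b κ₁ κ₂ β γ T) (t : ℝ) : ℝ :=
  ∫ s in (0 : ℝ)..t, tInt fun x =>
    kappa κ₁ κ₂ β (S.v s x) (S.θ s x) * (pt S.θ s x) ^ 2 / S.v s x

/-- The auxiliary function `𝔜(t) = max_{0 ≤ s ≤ t} ∫_𝕋 κ(v,θ)² θ_x² / v² dx`. -/
def Sol.Y (S : Sol μ R a b κ₁ κ₂ β γ T) (t : ℝ) : ℝ :=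
  sSup ((fun s => tInt fun x =>
    (kappa κ₁ κ₂ β (S.v s x) (S.θ s x)) ^ 2 * (px S.θ s x) ^ 2 / (S.v s x) ^ 2) ''
      Icc (0 : ℝ) t)

/-- The auxiliary function `ℨ(t) = max_{0 ≤ s ≤ t} ∫_𝕋 u_{xx}² / v² dx`. -/
def Sol.Z (S : Sol μ R a b κ₁ κ₂ β γ T) (t : ℝ) : ℝ :=
  sSup ((fun s => tInt fun x => (px (px S.u) s x) ^ 2 / (S.v s x) ^ 2) '' Icc (0 : ℝ) t)

/-- The exponent `𝔗₀(n, p, β)`. -/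
def T0 (n _p β : ℝ) : ℝ :=
  if n < (β + 3) / 2 then 4 / (n * (2 * β + 3)) else (n - β + 5) / (n * (2 * β + 3))

/-- The exponent `𝔗₁(n, β)`. -/
def T1 (n β : ℝ) : ℝ := max (T0 n 8 β) (1 / (2 * β + 3) + T0 n 1 β)

/-- The exponent `𝔘ʸ₁₁(n, β)`. -/
def Uy11 (n β : ℝ) : ℝ := 2 / (2 * β + 3) + T0 n 1 β

/-- The exponent `𝔘ᶻ₁₁(n, β)`. -/
def Uz11 (n β : ℝ) : ℝ := 3 / 4 * (1 / (1 - T0 n (5/2) β))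

/-- The exponent `𝔘ʸ₂(n, β)`. -/
def Uy2 (n β : ℝ) : ℝ := 2 / (2 * β + 3) + T1 n β

/-- The exponent `𝔘ᶻ₂(n, β)`. -/
def Uz2 (n β : ℝ) : ℝ := 3 / 4 * (1 / (1 - T0 n (3/2) β - T1 n β))

end RadHydro

open RadHydro

namespace RadHydro

lemma contDiff_px {f : ℝ → ℝ → ℝ}
    (hf : ContDiff ℝ (⊤ : ℕ∞) fun p : ℝ × ℝ => f p.1 p.2) :
    ContDiff ℝ (⊤ : ℕ∞) fun p : ℝ × ℝ => px f p.1 p.2 := by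
  have key : (fun p : ℝ × ℝ => px f p.1 p.2)
      = fun p => fderiv ℝ (fun p : ℝ × ℝ => f p.1 p.2) p (0, 1) := by
    ext p
    have h1 : HasFDerivAt (fun p : ℝ × ℝ => f p.1 p.2)
        (fderiv ℝ (fun p : ℝ × ℝ => f p.1 p.2) (p.1, p.2)) (p.1, p.2) :=
      (hf.differentiable (by simp) _).hasFDerivAt
    have h2 : HasDerivAt (fun y : ℝ => (p.1, y)) ((0 : ℝ), (1 : ℝ)) p.2 :=
      (hasDerivAt_const _ _).prodMk (hasDerivAt_id _)
    exact (h1.comp_hasDerivAt p.2 h2).deriv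
  rw [key]
  exact (hf.fderiv_right (m := (⊤ : ℕ∞)) (by simp)).clm_apply contDiff_const

lemma contDiff_pt {f : ℝ → ℝ → ℝ}
    (hf : ContDiff ℝ (⊤ : ℕ∞) fun p : ℝ × ℝ => f p.1 p.2) :
    ContDiff ℝ (⊤ : ℕ∞) fun p : ℝ × ℝ => pt f p.1 p.2 := by
  have hswap : ContDiff ℝ (⊤ : ℕ∞) fun p : ℝ × ℝ => (fun x t => f t x) p.1 p.2 :=
    hf.comp (contDiff_snd.prodMk contDiff_fst)
  exact (contDiff_px (f := fun x t => f t x) hswap).comp (contDiff_snd.prodMk contDiff_fst)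

lemma contDiff_slice {f : ℝ → ℝ → ℝ}
    (hf : ContDiff ℝ (⊤ : ℕ∞) fun p : ℝ × ℝ => f p.1 p.2) (t : ℝ) :
    ContDiff ℝ (⊤ : ℕ∞) (f t) :=
  hf.comp (contDiff_const.prodMk contDiff_id)

lemma hasDerivAt_tInt {f : ℝ → ℝ → ℝ}
    (hf : ContDiff ℝ (⊤ : ℕ∞) fun p : ℝ × ℝ => f p.1 p.2) (t : ℝ) :
    HasDerivAt (fun s => tInt (f s)) (tInt (pt f t)) t := by
  have hc := (contDiff_pt hf).continuous
  obtain ⟨B, hB⟩ := ((isCompact_Icc (a := t - 1) (b := t + 1)).prod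
    (isCompact_Icc (a := (-(1/2) : ℝ)) (b := 1/2))).exists_bound_of_continuousOn
      hc.continuousOn
  refine (intervalIntegral.hasDerivAt_integral_of_dominated_loc_of_deriv_le
    (F := f) (F' := pt f) (bound := fun _ => B)
    (Icc_mem_nhds (show t - 1 < t by linarith) (show t < t + 1 by linarith))
    (.of_forall fun s => (contDiff_slice hf s).continuous.aestronglyMeasurable)
    ((contDiff_slice hf t).continuous.intervalIntegrable _ _)
    (contDiff_slice (contDiff_pt hf) t).continuous.aestronglyMeasurable
    (.of_forall fun x hx s hs => hB (s, x) ⟨hs, ?_⟩)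
    intervalIntegrable_const
    (.of_forall fun x _ s _ => ?_)).2
  · rw [uIoc_of_le (by norm_num)] at hx
    exact Ioc_subset_Icc_self hx
  · have : ContDiff ℝ (⊤ : ℕ∞) fun s => f s x := hf.comp (contDiff_id.prodMk contDiff_const)
    exact (this.differentiable (by simp) s).hasDerivAt

lemma continuous_tInt {f : ℝ → ℝ → ℝ} (hf : Continuous fun p : ℝ × ℝ => f p.1 p.2) :
    Continuous fun s => tInt (f s) :=
  intervalIntegral.continuous_parametric_intervalIntegral_of_continuous' hf _ _

lemma tInt_add {f g : ℝ → ℝ} (hf : Continuous f) (hg : Continuous g) :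
    tInt (fun x => f x + g x) = tInt f + tInt g :=
  intervalIntegral.integral_add (hf.intervalIntegrable _ _) (hg.intervalIntegrable _ _)

lemma tInt_const_mul (c : ℝ) (f : ℝ → ℝ) : tInt (fun x => c * f x) = c * tInt f :=
  intervalIntegral.integral_const_mul _ _

lemma tInt_const (c : ℝ) : tInt (fun _ => c) = c := by
  norm_num [tInt]

lemma tInt_mono {f g : ℝ → ℝ} (hf : Continuous f) (hg : Continuous g) (h : ∀ x, f x ≤ g x) :
    tInt f ≤ tInt g :=
  intervalIntegral.integral_mono (by norm_num) (hf.intervalIntegrable _ _)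
    (hg.intervalIntegrable _ _) h

lemma tInt_nonneg {f : ℝ → ℝ} (h : ∀ x, 0 ≤ f x) : 0 ≤ tInt f :=
  intervalIntegral.integral_nonneg (by norm_num) fun x _ => h x

lemma tInt_px_eq_zero {f : ℝ → ℝ → ℝ}
    (hf : ContDiff ℝ (⊤ : ℕ∞) fun p : ℝ × ℝ => f p.1 p.2) (t : ℝ)
    (hp : Function.Periodic (f t) 1) : tInt (px f t) = 0 := by
  have h := intervalIntegral.integral_deriv_eq_sub (a := (-(1/2) : ℝ)) (b := 1/2)
    (fun x _ => (contDiff_slice hf t).differentiable (by simp) x)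
    ((contDiff_slice (contDiff_px hf) t).continuous.intervalIntegrable _ _)
  have h2 := hp (-(1/2))
  norm_num at h2
  change (∫ x in (-(1/2) : ℝ)..(1/2 : ℝ), deriv (f t) x) = 0
  rw [h]
  norm_num
  linarith

lemma periodic_px {f : ℝ → ℝ → ℝ} (t : ℝ) (hp : Function.Periodic (f t) 1) :
    Function.Periodic (px f t) 1 := by
  intro x
  change deriv (f t) (x + 1) = deriv (f t) x
  rw [← deriv_comp_add_const]
  exact congrArg (fun g => deriv g x) (funext hp)

lemma rpow_le_of_tInt_le {f : ℝ → ℝ} (hf : ContDiff ℝ (⊤ : ℕ∞) f) (hpos : ∀ x, 0 < f x)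
    {β K G l : ℝ} (hβ : 0 < β) (hl : 0 < l) (hK : tInt f ≤ K)
    (hG : tInt (fun x => f x ^ (2 * β) * deriv f x ^ 2) ≤ G)
    {x : ℝ} (hx : x ∈ Icc (-(1/2) : ℝ) (1/2)) :
    f x ^ (β + 3 / 2) ≤ K ^ (β + 3 / 2) + (β + 3 / 2) * ((l * K + l⁻¹ * G) / 2) := by
  have hfc := hf.continuous
  have hdc : Continuous (deriv f) := hf.continuous_deriv (by simp)
  have hpow (r : ℝ) : Continuous fun x => f x ^ r :=
    hfc.rpow_const fun x => Or.inl (hpos x).ne'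
  obtain ⟨x₀, hx₀, he⟩ := exists_eq_interval_average (f := f) (a := -(1/2)) (b := 1/2)
    (by norm_num) hfc.continuousOn
  rw [interval_average_eq] at he
  norm_num at he
  have hx₀K : f x₀ ≤ K := by
    rw [he]; refine le_trans (le_of_eq ?_) hK; norm_num [tInt]
  rw [uIoo_of_le (by norm_num)] at hx₀
  have hder (y : ℝ) : HasDerivAt (fun x => f x ^ (β + 3 / 2))
      ((β + 3 / 2) * (f y ^ (β + 1 / 2) * deriv f y)) y := by
    have := ((hf.differentiable (by simp) y).hasDerivAt).rpow_const (p := β + 3 / 2)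
      (Or.inl (hpos y).ne')
    convert this using 1
    rw [show β + 3 / 2 - 1 = β + 1 / 2 by ring]; ring
  have hgc : Continuous fun y => f y ^ (β + 1 / 2) * deriv f y := (hpow _).mul hdc
  have hFTC := intervalIntegral.integral_eq_sub_of_hasDerivAt (a := x₀) (b := x)
    (fun y _ => hder y) ((continuous_const.mul hgc).intervalIntegrable _ _)
  rw [intervalIntegral.integral_const_mul] at hFTC
  have h1 : |∫ y in x₀..x, f y ^ (β + 1 / 2) * deriv f y|
      ≤ tInt fun y => |f y ^ (β + 1 / 2) * deriv f y| := by
    refine (intervalIntegral.norm_integral_le_abs_integral_norm (μ := volume)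
      (f := fun y => f y ^ (β + 1 / 2) * deriv f y)).trans ?_
    refine (intervalIntegral.abs_integral_mono_interval (c := -(1/2)) (d := 1/2) ?_
      (.of_forall fun y => norm_nonneg _) (hgc.norm.intervalIntegrable _ _)).trans
      (le_of_eq (abs_of_nonneg (tInt_nonneg fun y => norm_nonneg _)))
    rw [uIoc_of_le (by norm_num : (-(1/2) : ℝ) ≤ 1/2)]
    exact Ioc_subset_Ioc (le_min hx₀.1.le hx.1) (max_le hx₀.2.le hx.2)
  have h2 : (tInt fun y => |f y ^ (β + 1 / 2) * deriv f y|)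
      ≤ tInt fun y => l / 2 * f y + l⁻¹ / 2 * (f y ^ (2 * β) * deriv f y ^ 2) := by
    refine tInt_mono hgc.abs ((continuous_const.mul hfc).add
      (continuous_const.mul ((hpow _).mul (hdc.pow 2)))) fun y => ?_
    have hy := hpos y
    have e1 : f y ^ (β + 1 / 2) = f y ^ β * √(f y) := by
      rw [rpow_add hy, sqrt_eq_rpow]
    have e2 : f y ^ (2 * β) = (f y ^ β) ^ 2 := by
      rw [two_mul, rpow_add hy, sq]
    have e3 := sq_sqrt hy.le
    have e4 : 0 < f y ^ β := rpow_pos_of_pos hy _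
    rw [e1, e2, abs_mul, abs_of_nonneg (mul_nonneg e4.le (sqrt_nonneg _))]
    set r := √(f y)
    set s := f y ^ β
    rw [← e3, ← sq_abs (deriv f y)]
    set d := |deriv f y|
    have : l / 2 * r ^ 2 + l⁻¹ / 2 * (s ^ 2 * d ^ 2) - s * r * d
        = l⁻¹ / 2 * (l * r - s * d) ^ 2 := by
      field_simp; ring
    have : 0 ≤ l⁻¹ / 2 * (l * r - s * d) ^ 2 := by positivity
    linarith
  rw [tInt_add (f := fun y => l / 2 * f y)
      (g := fun y => l⁻¹ / 2 * (f y ^ (2 * β) * deriv f y ^ 2)) (continuous_const.mul hfc)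
      (continuous_const.mul ((hpow _).mul (hdc.pow 2))), tInt_const_mul, tInt_const_mul] at h2
  have h3 : l / 2 * tInt f ≤ l / 2 * K := by gcongr
  have h4 : l⁻¹ / 2 * tInt (fun y => f y ^ (2 * β) * deriv f y ^ 2) ≤ l⁻¹ / 2 * G := by gcongr
  have h5 : f x₀ ^ (β + 3 / 2) ≤ K ^ (β + 3 / 2) :=
    rpow_le_rpow (hpos x₀).le hx₀K (by positivity)
  have h6 : (∫ y in x₀..x, f y ^ (β + 1 / 2) * deriv f y) ≤ (l * K + l⁻¹ * G) / 2 := by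
    linarith [le_abs_self (∫ y in x₀..x, f y ^ (β + 1 / 2) * deriv f y)]
  have h7 := mul_le_mul_of_nonneg_left h6 (show 0 ≤ β + 3 / 2 by positivity)
  linarith

lemma contDiff_kappa {μ R a b κ₁ κ₂ β γ T : ℝ} (S : Sol μ R a b κ₁ κ₂ β γ T) :
    ContDiff ℝ (⊤ : ℕ∞) fun p : ℝ × ℝ => kappa κ₁ κ₂ β (S.v p.1 p.2) (S.θ p.1 p.2) := by
  unfold kappa
  exact contDiff_const.add ((contDiff_const.mul S.smooth_v).mul
    (S.smooth_θ.rpow_const_of_ne fun p => (S.θ_pos p.1 p.2).ne'))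

/-- Conservation of the total energy. -/
lemma tInt_energy_eq {μ R a b κ₁ κ₂ β γ T : ℝ} (S : Sol μ R a b κ₁ κ₂ β γ T)
    {t : ℝ} (ht : t ∈ Icc 0 T) :
    tInt (fun y => R / (γ - 1) * S.θ t y + S.u t y ^ 2 / 2)
      = tInt (fun y => R / (γ - 1) * S.θ 0 y + S.u 0 y ^ 2 / 2) := by
  have hv := S.smooth_v
  have hu := S.smooth_u
  have hθ := S.smooth_θ
  have hq := S.smooth_q
  have hux := contDiff_px hu
  have hθx := contDiff_px hθ
  have hκ := contDiff_kappa S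
  have hne : ∀ p : ℝ × ℝ, S.v p.1 p.2 ≠ 0 := fun p => (S.v_pos _ _).ne'
  let E : ℝ → ℝ → ℝ := fun s y => R / (γ - 1) * S.θ s y + S.u s y ^ 2 / 2
  let A : ℝ → ℝ → ℝ := fun s y => R * S.θ s y / S.v s y * S.u s y
  let B : ℝ → ℝ → ℝ := fun s y => μ * S.u s y * px S.u s y / S.v s y
  let D : ℝ → ℝ → ℝ := fun s y =>
    kappa κ₁ κ₂ β (S.v s y) (S.θ s y) * px S.θ s y / S.v s y
  have hE : ContDiff ℝ (⊤ : ℕ∞) fun p : ℝ × ℝ => E p.1 p.2 :=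
    (contDiff_const.mul hθ).add ((hu.pow 2).div_const 2)
  have hA : ContDiff ℝ (⊤ : ℕ∞) fun p : ℝ × ℝ => A p.1 p.2 :=
    ((contDiff_const.mul hθ).div hv hne).mul hu
  have hB : ContDiff ℝ (⊤ : ℕ∞) fun p : ℝ × ℝ => B p.1 p.2 :=
    ((contDiff_const.mul hu).mul hux).div hv hne
  have hD : ContDiff ℝ (⊤ : ℕ∞) fun p : ℝ × ℝ => D p.1 p.2 :=
    (hκ.mul hθx).div hv hne
  have hd (s : ℝ) (hs : s ∈ Icc 0 T) : tInt (pt E s) = 0 := by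
    have pv := S.periodic_v s
    have pu := S.periodic_u s
    have pθ := S.periodic_θ s
    have pux := periodic_px s pu
    have pθx := periodic_px s pθ
    have zA := tInt_px_eq_zero hA s fun x => by simp only [A, pv x, pu x, pθ x]
    have zq := tInt_px_eq_zero hq s (S.periodic_q s)
    have zB := tInt_px_eq_zero hB s fun x => by simp only [B, pv x, pu x, pux x]
    have zD := tInt_px_eq_zero hD s fun x => by simp only [D, pv x, pθ x, pθx x]
    have cE := (contDiff_slice (contDiff_pt hE) s).continuous
    have cA := (contDiff_slice (contDiff_px hA) s).continuous
    have cq := (contDiff_slice (contDiff_px hq) s).continuous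
    have cB := (contDiff_slice (contDiff_px hB) s).continuous
    have cD := (contDiff_slice (contDiff_px hD) s).continuous
    have h : tInt (fun x => (pt E s x + px A s x) + px S.q s x)
        = tInt (fun x => px B s x + px D s x) := congrArg tInt (funext (S.eq_energy s hs))
    rw [tInt_add (f := fun x => pt E s x + px A s x) (cE.add cA) cq, tInt_add cE cA,
      tInt_add cB cD, zA, zq, zB, zD] at h
    simpa using h
  refine constant_of_has_deriv_right_zero (f := fun t => tInt (E t))
    (fun s _ => (hasDerivAt_tInt hE s).continuousAt.continuousWithinAt)
    (fun s hs => ?_) t ht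
  have := (hasDerivAt_tInt hE s).hasDerivWithinAt (s := Ici s)
  rwa [hd s (Ico_subset_Icc_self hs)] at this

lemma tInt_temperature_le {μ R a b κ₁ κ₂ β γ T M ε : ℝ} (S : Sol μ R a b κ₁ κ₂ β γ T)
    (hR : 0 < R) (hγ : 1 < γ) (hS : S.Bounded M ε) {t : ℝ} (ht : t ∈ Icc 0 T) :
    tInt (S.θ t) ≤ (1 + M ^ 2) / 2 + (γ - 1) / R * (M ^ 2 / 2) := by
  have hM := (Real.sqrt_le_iff.1 hS.1).2
  have hn (f : ℝ → ℝ) : 0 ≤ L2sq f := tInt_nonneg fun x => sq_nonneg _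
  unfold H2sq at hM
  have hθM : L2sq (S.θ 0) ≤ M ^ 2 := by
    linarith [hn (S.v 0), hn (deriv (S.v 0)), hn (deriv (deriv (S.v 0))), hn (S.u 0),
      hn (deriv (S.u 0)), hn (deriv (deriv (S.u 0))), hn (deriv (S.θ 0)),
      hn (deriv (deriv (S.θ 0)))]
  have huM : L2sq (S.u 0) ≤ M ^ 2 := by
    linarith [hn (S.v 0), hn (deriv (S.v 0)), hn (deriv (deriv (S.v 0))), hn (S.θ 0),
      hn (deriv (S.u 0)), hn (deriv (deriv (S.u 0))), hn (deriv (S.θ 0)),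
      hn (deriv (deriv (S.θ 0)))]
  have cθ (s : ℝ) := (contDiff_slice S.smooth_θ s).continuous
  have cu (s : ℝ) := (contDiff_slice S.smooth_u s).continuous
  have hsplit (s : ℝ) : tInt (fun y => R / (γ - 1) * S.θ s y + S.u s y ^ 2 / 2)
      = R / (γ - 1) * tInt (S.θ s) + 1 / 2 * L2sq (S.u s) := by
    rw [tInt_add (f := fun y => R / (γ - 1) * S.θ s y) (g := fun y => S.u s y ^ 2 / 2)
      (continuous_const.mul (cθ s)) (((cu s).pow 2).div_const 2), tInt_const_mul, L2sq,
      ← tInt_const_mul (1 / 2)]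
    simp only [one_div_mul_eq_div]
  have hθ₀ : tInt (S.θ 0) ≤ (1 + M ^ 2) / 2 := by
    have h := tInt_mono (f := S.θ 0) (g := fun x => 1 / 2 + 1 / 2 * S.θ 0 x ^ 2) (cθ 0)
      (continuous_const.add (continuous_const.mul ((cθ 0).pow 2)))
      fun x => by nlinarith [sq_nonneg (S.θ 0 x - 1)]
    rw [tInt_add (g := fun x => 1 / 2 * S.θ 0 x ^ 2) continuous_const
      (continuous_const.mul ((cθ 0).pow 2)), tInt_const,
      tInt_const_mul] at h
    change _ ≤ _ + 1 / 2 * L2sq (S.θ 0) at h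
    linarith
  have hE := tInt_energy_eq S ht
  rw [hsplit, hsplit] at hE
  have hγ' : 0 < γ - 1 := by linarith
  have hc : 0 < R / (γ - 1) := by positivity
  have h1 : R / (γ - 1) * tInt (S.θ t) ≤
      R / (γ - 1) * ((1 + M ^ 2) / 2 + (γ - 1) / R * (M ^ 2 / 2)) := by
    have h2 := mul_le_mul_of_nonneg_left hθ₀ hc.le
    have h3 : R / (γ - 1) * ((1 + M ^ 2) / 2 + (γ - 1) / R * (M ^ 2 / 2))
        = R / (γ - 1) * ((1 + M ^ 2) / 2) + M ^ 2 / 2 := by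
      field_simp
    linarith [hn (S.u t)]
  exact le_of_mul_le_mul_left h1 hc

lemma tInt_rpow_mul_deriv_sq_le {μ R a b κ₁ κ₂ β γ T : ℝ} (S : Sol μ R a b κ₁ κ₂ β γ T)
    (hκ₁ : 0 < κ₁) (hκ₂ : 0 < κ₂) {t : ℝ} (ht : 0 ≤ t) :
    tInt (fun x => S.θ t x ^ (2 * β) * deriv (S.θ t) x ^ 2) ≤ S.Y t / κ₂ ^ 2 := by
  have hne : ∀ p : ℝ × ℝ, S.v p.1 p.2 ^ 2 ≠ 0 := fun p => pow_ne_zero _ (S.v_pos _ _).ne'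
  let F : ℝ → ℝ → ℝ := fun s x =>
    kappa κ₁ κ₂ β (S.v s x) (S.θ s x) ^ 2 * px S.θ s x ^ 2 / S.v s x ^ 2
  have hF : ContDiff ℝ (⊤ : ℕ∞) fun p : ℝ × ℝ => F p.1 p.2 :=
    (((contDiff_kappa S).pow 2).mul ((contDiff_px S.smooth_θ).pow 2)).div (S.smooth_v.pow 2) hne
  have hbdd := (isCompact_Icc (a := (0 : ℝ)) (b := t)).bddAbove_image
    (continuous_tInt (f := F) hF.continuous).continuousOn
  have hY : tInt (F t) ≤ S.Y t := le_csSup hbdd ⟨t, right_mem_Icc.2 ht, rfl⟩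
  rw [le_div_iff₀ (by positivity), mul_comm, ← tInt_const_mul]
  refine le_trans (tInt_mono ?_ (contDiff_slice hF t).continuous fun x => ?_) hY
  · have cθ := contDiff_slice S.smooth_θ t
    exact continuous_const.mul
      ((cθ.continuous.rpow_const fun x => Or.inl (S.θ_pos t x).ne').mul
        ((cθ.continuous_deriv (by simp)).pow 2))
  · have hv := S.v_pos t x
    have hθ := S.θ_pos t x
    have e : S.θ t x ^ (2 * β) = (S.θ t x ^ β) ^ 2 := by
      rw [two_mul, rpow_add hθ, sq]
    have hp : 0 < S.θ t x ^ β := rpow_pos_of_pos hθ _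
    have hk : κ₂ * S.v t x * S.θ t x ^ β ≤ kappa κ₁ κ₂ β (S.v t x) (S.θ t x) := by
      unfold kappa; linarith
    simp only [F]
    rw [le_div_iff₀ (by positivity), e]
    calc κ₂ ^ 2 * ((S.θ t x ^ β) ^ 2 * deriv (S.θ t) x ^ 2) * S.v t x ^ 2
        = (κ₂ * S.v t x * S.θ t x ^ β) ^ 2 * deriv (S.θ t) x ^ 2 := by ring
      _ ≤ _ := by
        unfold px
        gcongr

end RadHydro

theorem stmt_4 (μ R a b κ₁ κ₂ β γ : ℝ)
    (hμ : 0 < μ) (hR : 0 < R) (ha : 0 < a) (hb : 0 < b)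
    (hκ₁ : 0 < κ₁) (hκ₂ : 0 < κ₂) (hβ : 0 < β) (hγ : 1 < γ)
    (T M ε : ℝ) (hT : 0 < T) (hM : 1 ≤ M) (hε0 : 0 < ε) (hε1 : ε ≤ 1) :
    ∃ C : ℝ, 0 < C ∧
      ∀ S : Sol μ R a b κ₁ κ₂ β γ T, S.Bounded M ε →
        ∀ t ∈ Icc (0 : ℝ) T,
          Linf (S.θ t) ≤ C * (1 + S.Y t ^ (1 / (2 * β + 3))) := by
  set K : ℝ := (1 + M ^ 2) / 2 + (γ - 1) / R * (M ^ 2 / 2)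
  have hγ' : 0 < γ - 1 := by linarith
  have hK : 0 < K := by positivity
  set A : ℝ := K ^ (β + 3 / 2) + (β + 3 / 2) * ((K + 1 / κ₂ ^ 2) / 2) with hAdef
  have hA : 0 < A := by positivity
  refine ⟨A ^ (1 / (β + 3 / 2)), by positivity, fun S hS t ht => ?_⟩
  have hθK : tInt (S.θ t) ≤ K := tInt_temperature_le S hR hγ hS ht
  have hG := tInt_rpow_mul_deriv_sq_le S hκ₁ hκ₂ ht.1
  have hY : 0 ≤ S.Y t := by
    refine Real.sSup_nonneg ?_
    rintro _ ⟨s, _, rfl⟩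
    exact tInt_nonneg fun x => by positivity
  refine csSup_le ((nonempty_Icc.2 (by norm_num)).image _) ?_
  rintro _ ⟨x, hx, rfl⟩
  change |S.θ t x| ≤ _
  have hθ := S.θ_pos t x
  rw [abs_of_pos hθ]
  set l := √(1 + S.Y t) with hldef
  have hl1 : 1 ≤ l := Real.one_le_sqrt.2 (by linarith)
  have hl : 0 < l := by linarith
  have hl2 : l ^ 2 = 1 + S.Y t := Real.sq_sqrt (by linarith)
  have h := rpow_le_of_tInt_le (contDiff_slice S.smooth_θ t) (S.θ_pos t) hβ hl hθK hG hx
  have h1 : l⁻¹ * (S.Y t / κ₂ ^ 2) ≤ l * (1 / κ₂ ^ 2) := by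
    rw [inv_mul_le_iff₀ hl, ← mul_assoc, ← sq, hl2, mul_one_div]
    gcongr
    linarith
  have h2 : S.θ t x ^ (β + 3 / 2) ≤ A * l := by
    have h3 : K ^ (β + 3 / 2) ≤ K ^ (β + 3 / 2) * l :=
      le_mul_of_one_le_right (by positivity) hl1
    have h4 : (β + 3 / 2) * ((l * K + l⁻¹ * (S.Y t / κ₂ ^ 2)) / 2)
        ≤ (β + 3 / 2) * ((l * K + l * (1 / κ₂ ^ 2)) / 2) := by gcongr
    calc _ ≤ _ := h
      _ ≤ K ^ (β + 3 / 2) * l + (β + 3 / 2) * ((l * K + l * (1 / κ₂ ^ 2)) / 2) := by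
        linarith
      _ = A * l := by rw [hAdef]; ring
  have h5 : l ^ (1 / (β + 3 / 2)) = (1 + S.Y t) ^ (1 / (2 * β + 3)) := by
    rw [hldef, Real.sqrt_eq_rpow, ← Real.rpow_mul (by linarith)]
    congr 1
    field_simp
  calc S.θ t x = (S.θ t x ^ (β + 3 / 2)) ^ (1 / (β + 3 / 2)) := by
        rw [← Real.rpow_mul hθ.le, mul_one_div_cancel (by positivity), Real.rpow_one]
    _ ≤ (A * l) ^ (1 / (β + 3 / 2)) := by gcongr
    _ = A ^ (1 / (β + 3 / 2)) * (1 + S.Y t) ^ (1 / (2 * β + 3)) := by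
        rw [Real.mul_rpow hA.le hl.le, h5]
    _ ≤ A ^ (1 / (β + 3 / 2)) * (1 + S.Y t ^ (1 / (2 * β + 3))) := by
        gcongr
        have := Real.rpow_add_le_add_rpow zero_le_one hY
          (show 0 ≤ 1 / (2 * β + 3) by positivity)
          (by rw [div_le_one (by positivity)]; linarith)
        simpa using this
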